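/- Suppose the point x ≠ 0 lies outside the sensing region, so that ∇_x Ψ(t,x) = 0 and ∂²Ψ/∂x_j²(t,x) = 0 for all j = 1,…,n. Then the divergence of the closed-loop density flux admits the lower bound div_x( k ρ_o )(t,x) ≥ (α β n / V₁(x)^{2α}) [ (2α+1) ( d̄_V ‖x‖² + κ )^{-2} θ² d_{Vx}² ‖x‖² − d_V^{-1} d̄_{Vx²} ‖x‖^{-2} ]. -/

import Mathlib

open Set

/-- Divergence of a vector field on `ℝⁿ` (Euclidean space). -/
noncomputable def divergence {n : ℕ}
    (F : EuclideanSpace ℝ (Fin n) → EuclideanSpace ℝ (Fin n))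
    (x : EuclideanSpace ℝ (Fin n)) : ℝ :=
  ∑ j : Fin n, fderiv ℝ F x (EuclideanSpace.single j 1) j

/-- First partial derivative `∂g/∂x_j`. -/
noncomputable def pd {n : ℕ} (j : Fin n)
    (g : EuclideanSpace ℝ (Fin n) → ℝ) (x : EuclideanSpace ℝ (Fin n)) : ℝ :=
  fderiv ℝ g x (EuclideanSpace.single j 1)

/-- Second partial derivative `∂²g/∂x_j²`. -/
noncomputable def pd2 {n : ℕ} (j : Fin n)
    (g : EuclideanSpace ℝ (Fin n) → ℝ) (x : EuclideanSpace ℝ (Fin n)) : ℝ :=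
  fderiv ℝ (fun y => fderiv ℝ g y (EuclideanSpace.single j 1)) x (EuclideanSpace.single j 1)

lemma aux_rho_fd {n : ℕ} (f V : EuclideanSpace ℝ (Fin n) → ℝ) (κ a : ℝ) (hκ : 0 < κ)
    (y e : EuclideanSpace ℝ (Fin n)) (hVnn : ∀ y, 0 ≤ V y)
    (hf : DifferentiableAt ℝ f y) (hV : DifferentiableAt ℝ V y) :
    fderiv ℝ (fun z => f z * (V z + κ) ^ a) y e =
      fderiv ℝ f y e * (V y + κ) ^ a + a * (f y * fderiv ℝ V y e) * (V y + κ) ^ (a - 1) := by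
  have hp : V y + κ ≠ 0 := by have := hVnn y; positivity
  have h1 : HasFDerivAt (fun z => V z + κ) (fderiv ℝ V y) y := hV.hasFDerivAt.add_const κ
  have h2 := h1.rpow_const (p := a) (Or.inl hp)
  have h3 := hf.hasFDerivAt.mul h2
  have h4 : HasFDerivAt (fun z => f z * (V z + κ) ^ a) _ y := h3
  rw [h4.fderiv]
  simp
  ring

lemma aux_div {n : ℕ} (ρ : EuclideanSpace ℝ (Fin n) → ℝ) (β : ℝ) (hρ : ContDiff ℝ 2 ρ)
    (x : EuclideanSpace ℝ (Fin n)) :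
    divergence (fun y => ρ y • (β • gradient ρ y)) x =
      ∑ j, β * ((pd j ρ x) ^ 2 + ρ x * pd2 j ρ x) := by
  unfold divergence
  refine Finset.sum_congr rfl fun j _ => ?_
  have hd : Differentiable ℝ ρ := hρ.differentiable (by norm_num)
  have hd1 : Differentiable ℝ (fderiv ℝ ρ) :=
    (hρ.fderiv_right (m := 1) (by norm_num)).differentiable (by norm_num)
  have hg : Differentiable ℝ (gradient ρ) := by
    intro y
    exact ((InnerProductSpace.toDual ℝ (EuclideanSpace ℝ (Fin n))).symm.toContinuousLinearEquiv.differentiableAt).comp y (hd1 y)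
  have hF : DifferentiableAt ℝ (fun y => ρ y • (β • gradient ρ y)) x :=
    (hd x).smul ((hg x).const_smul β)
  have hc : ∀ y, gradient ρ y j = fderiv ℝ ρ y (EuclideanSpace.single j 1) := by
    intro y
    have h := InnerProductSpace.toDual_symm_apply (𝕜 := ℝ) (x := EuclideanSpace.single j (1:ℝ)) (y := fderiv ℝ ρ y)
    rw [← h, EuclideanSpace.inner_single_right]
    simp [gradient]
  have e1 := ((EuclideanSpace.proj j : EuclideanSpace ℝ (Fin n) →L[ℝ] ℝ).hasFDerivAt.comp x hF.hasFDerivAt)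
  have e2 : fderiv ℝ (fun y => ρ y • (β • gradient ρ y)) x (EuclideanSpace.single j 1) j =
      fderiv ℝ (fun y => ρ y * (β * fderiv ℝ ρ y (EuclideanSpace.single j 1))) x (EuclideanSpace.single j 1) := by
    have : (fun y => ρ y * (β * fderiv ℝ ρ y (EuclideanSpace.single j 1))) =
      (EuclideanSpace.proj j : EuclideanSpace ℝ (Fin n) →L[ℝ] ℝ) ∘ (fun y => ρ y • (β • gradient ρ y)) := by
      funext y
      simp [hc]
    rw [this, e1.fderiv]
    simp
  rw [e2]
  have h5 : DifferentiableAt ℝ (fun y => fderiv ℝ ρ y (EuclideanSpace.single j 1)) x :=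
    (hd1 x).clm_apply (differentiableAt_const _)
  have h6 : HasFDerivAt (fun y => ρ y * (β * fderiv ℝ ρ y (EuclideanSpace.single j 1))) _ x :=
    (hd x).hasFDerivAt.mul (h5.hasFDerivAt.const_mul β)
  rw [h6.fderiv]
  simp [pd, pd2]
  ring

lemma aux_ineq (α θ κ P W v w r dV dVbar dVx d2 : ℝ) (hα : 0 < α) (hθ : 0 < θ) (hκ : 0 < κ)
    (hP : θ ≤ P) (hP1 : P ≤ 1) (hr : 0 < r) (hdV : 0 < dV) (hdVx : 0 < dVx) (hd2 : 0 < d2)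
    (hw : w ≤ d2) (hW1 : dV * r ^ 2 ≤ W) (hW2 : W ≤ dVbar * r ^ 2 + κ) (hv : dVx * r ≤ |v|) :
    (2 * α + 1) * ((dVbar * r ^ 2 + κ) ^ 2)⁻¹ * θ ^ 2 * dVx ^ 2 * r ^ 2
          - dV⁻¹ * d2 * (r ^ 2)⁻¹ ≤ P ^ 2 * ((2 * α + 1) * v ^ 2 * (W ^ 2)⁻¹ - w * W⁻¹) := by
  have hW : 0 < W := lt_of_lt_of_le (by positivity) hW1
  have a1 : ((dVbar * r ^ 2 + κ) ^ 2)⁻¹ ≤ (W ^ 2)⁻¹ := by gcongr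
  have a2 : (dVx * r) ^ 2 ≤ v ^ 2 := by
    rw [← sq_abs v]; gcongr
  have a3 : θ ^ 2 ≤ P ^ 2 := by gcongr
  have b1 : (2 * α + 1) * (((dVbar * r ^ 2 + κ) ^ 2)⁻¹ * (θ ^ 2 * (dVx * r) ^ 2)) ≤
      (2 * α + 1) * ((W ^ 2)⁻¹ * (P ^ 2 * v ^ 2)) := by gcongr
  have c1 : W⁻¹ ≤ (dV * r ^ 2)⁻¹ := by gcongr
  have hP0 : 0 < P := hθ.trans_le hP
  have c2 : P ^ 2 * (w * W⁻¹) ≤ 1 * (d2 * (dV * r ^ 2)⁻¹) := by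
    calc P ^ 2 * (w * W⁻¹) ≤ P ^ 2 * (d2 * W⁻¹) := by gcongr
      _ ≤ 1 * (d2 * (dV * r ^ 2)⁻¹) := by
        gcongr
        exact pow_le_one₀ hP0.le hP1
  rw [mul_inv] at c2
  nlinarith [b1, c2]

/-- lower bound on the divergence of the closed-loop density flux at a
point `x ≠ 0` outside the sensing region, where all spatial derivatives of `Ψ` vanish. -/
theorem stmt6 {n : ℕ} (hn : 1 ≤ n)
    (α β κ θ : ℝ) (hα : 0 < α) (hβ : 0 < β) (hκ : 0 < κ) (hθ : θ ∈ Set.Ioo (0:ℝ) 1)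
    (Ψ : ℝ → EuclideanSpace ℝ (Fin n) → ℝ)
    (hΨ : ∀ s, ContDiff ℝ 2 (Ψ s))
    (hΨb : ∀ s y, θ ≤ Ψ s y ∧ Ψ s y ≤ 1)
    (V : EuclideanSpace ℝ (Fin n) → ℝ)
    (hV : ContDiff ℝ 2 V) (hVnn : ∀ y, 0 ≤ V y)
    (ρo : ℝ → EuclideanSpace ℝ (Fin n) → ℝ)
    (hρo : ρo = fun s y => Ψ s y / (V y + κ) ^ α)
    (k : ℝ → EuclideanSpace ℝ (Fin n) → EuclideanSpace ℝ (Fin n))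
    (hk : k = fun s y => β • gradient (ρo s) y)
    -- the point (t,x) considered and the constants of the uniform bounds
    (t : ℝ) (x : EuclideanSpace ℝ (Fin n)) (hx0 : x ≠ 0)
    (dV dVbar dVx dVxbar dVx2bar : ℝ)
    (hdV : 0 < dV) (hdVbar : 0 < dVbar) (hdVx : 0 < dVx) (hdVxbar : 0 < dVxbar)
    (hdVx2bar : 0 < dVx2bar)
    -- outside the sensing region the spatial derivatives of Ψ vanish
    (hΨx : ∀ j : Fin n, pd j (Ψ t) x = 0)
    (hΨx2 : ∀ j : Fin n, pd2 j (Ψ t) x = 0)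
    (hVx2 : ∀ j : Fin n, pd2 j V x ≤ dVx2bar)
    (hVb : dV * ‖x‖ ^ 2 ≤ V x ∧ V x ≤ dVbar * ‖x‖ ^ 2)
    (hVx : ∀ j : Fin n, dVx * ‖x‖ ≤ |pd j V x| ∧ |pd j V x| ≤ dVxbar * ‖x‖) :
    (α * β * n / (V x + κ) ^ (2 * α)) *
        ((2 * α + 1) * ((dVbar * ‖x‖ ^ 2 + κ) ^ 2)⁻¹ * θ ^ 2 * dVx ^ 2 * ‖x‖ ^ 2
          - dV⁻¹ * dVx2bar * (‖x‖ ^ 2)⁻¹)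
      ≤ divergence (fun y => ρo t y • k t y) x := by
  subst hk
  subst hρo
  have hp : ∀ y, 0 < V y + κ := fun y => by have := hVnn y; positivity
  have hρe : (fun y => Ψ t y / (V y + κ) ^ α) = fun y => Ψ t y * (V y + κ) ^ (-α) := by
    funext y
    rw [Real.rpow_neg (hp y).le, div_eq_mul_inv]
  have hΨd : Differentiable ℝ (Ψ t) := (hΨ t).differentiable (by norm_num)
  have hVd : Differentiable ℝ V := hV.differentiable (by norm_num)
  have hC : ContDiff ℝ 2 (fun y => Ψ t y * (V y + κ) ^ (-α)) :=
    (hΨ t).mul ((hV.add contDiff_const).rpow_const_of_ne fun y => (hp y).ne')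
  have hdiv : divergence (fun y => (fun s y => Ψ s y / (V y + κ) ^ α) t y •
      (fun s y => β • gradient ((fun s y => Ψ s y / (V y + κ) ^ α) s) y) t y) x =
      divergence (fun y => (fun y => Ψ t y * (V y + κ) ^ (-α)) y •
        (β • gradient (fun y => Ψ t y * (V y + κ) ^ (-α)) y)) x := by
    rw [← hρe]
  rw [hdiv, aux_div _ β hC]
  have hΨd1 : Differentiable ℝ (fderiv ℝ (Ψ t)) :=
    ((hΨ t).fderiv_right (m := 1) (by norm_num)).differentiable (by norm_num)
  have hVd1 : Differentiable ℝ (fderiv ℝ V) :=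
    (hV.fderiv_right (m := 1) (by norm_num)).differentiable (by norm_num)
  have hr : 0 < ‖x‖ := norm_pos_iff.mpr hx0
  have hW := hp x
  set W := V x + κ with hWdef
  have key : ∀ j : Fin n, α * β / W ^ (2 * α) *
        ((2 * α + 1) * ((dVbar * ‖x‖ ^ 2 + κ) ^ 2)⁻¹ * θ ^ 2 * dVx ^ 2 * ‖x‖ ^ 2
          - dV⁻¹ * dVx2bar * (‖x‖ ^ 2)⁻¹) ≤
      β * ((pd j (fun y => Ψ t y * (V y + κ) ^ (-α)) x) ^ 2 +
        (Ψ t x * W ^ (-α)) * pd2 j (fun y => Ψ t y * (V y + κ) ^ (-α)) x) := by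
    intro j
    have h1 : ∀ y, fderiv ℝ (fun y => Ψ t y * (V y + κ) ^ (-α)) y (EuclideanSpace.single j 1) =
      fderiv ℝ (Ψ t) y (EuclideanSpace.single j 1) * (V y + κ) ^ (-α) +
      (-α * (Ψ t y * fderiv ℝ V y (EuclideanSpace.single j 1))) * (V y + κ) ^ (-α - 1) := fun y =>
        aux_rho_fd (Ψ t) V κ (-α) hκ y _ hVnn (hΨd y) (hVd y)
    have g1 : DifferentiableAt ℝ (fun y => fderiv ℝ (Ψ t) y (EuclideanSpace.single j 1)) x :=
      (hΨd1 x).clm_apply (differentiableAt_const _)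
    have g2 : DifferentiableAt ℝ (fun y => fderiv ℝ V y (EuclideanSpace.single j 1)) x :=
      (hVd1 x).clm_apply (differentiableAt_const _)
    have g3 : HasFDerivAt (fun y => -α * (Ψ t y * fderiv ℝ V y (EuclideanSpace.single j 1))) _ x :=
      ((hΨd x).hasFDerivAt.mul g2.hasFDerivAt).const_mul (-α)
    have hrp : ∀ a : ℝ, DifferentiableAt ℝ (fun y => (V y + κ) ^ a) x := fun a =>
      ((hVd x).add_const κ).rpow_const (Or.inl hW.ne')
    have hpd : pd j (fun y => Ψ t y * (V y + κ) ^ (-α)) x =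
        -α * (Ψ t x * pd j V x) * W ^ (-α - 1) := by
      have h0 := hΨx j
      unfold pd at h0 ⊢
      rw [h1 x, h0]
      ring
    have hpd2 : pd2 j (fun y => Ψ t y * (V y + κ) ^ (-α)) x =
        -α * (Ψ t x * pd2 j V x) * W ^ (-α - 1) +
        (-α - 1) * (-α * (Ψ t x * pd j V x) * pd j V x) * W ^ (-α - 1 - 1) := by
      have h0 := hΨx j
      have h00 := hΨx2 j
      unfold pd at h0 ⊢
      unfold pd2 at h00 ⊢
      simp_rw [h1]
      rw [fderiv_fun_add (g1.fun_mul (hrp _)) (g3.differentiableAt.fun_mul (hrp _))]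
      rw [ContinuousLinearMap.add_apply, aux_rho_fd _ V κ (-α) hκ x _ hVnn g1 (hVd x),
        aux_rho_fd _ V κ (-α - 1) hκ x _ hVnn g3.differentiableAt (hVd x), g3.fderiv, h00, h0]
      simp [h0]
      ring
    have hI := aux_ineq α θ κ (Ψ t x) W (pd j V x) (pd2 j V x) ‖x‖ dV dVbar dVx dVx2bar hα hθ.1 hκ
      (hΨb t x).1 (hΨb t x).2 hr hdV hdVx hdVx2bar (hVx2 j) (by linarith [hVb.1])
      (by linarith [hVb.2]) (hVx j).1
    have hc : 0 ≤ α * β / W ^ (2 * α) := by positivity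
    refine (mul_le_mul_of_nonneg_left hI hc).trans (le_of_eq ?_)
    rw [hpd, hpd2]
    have r1 : W ^ (-α - 1) = W ^ (-α) * W⁻¹ := by
      rw [Real.rpow_sub_one hW.ne', div_eq_mul_inv]
    have r2 : W ^ (-α - 1 - 1) = W ^ (-α) * W⁻¹ * W⁻¹ := by
      rw [Real.rpow_sub_one hW.ne', r1, div_eq_mul_inv]
    have r3 : α * β / W ^ (2 * α) = α * β * (W ^ (-α) * W ^ (-α)) := by
      rw [← Real.rpow_add hW, div_eq_mul_inv, ← Real.rpow_neg hW.le]
      congr 2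
      ring
    rw [r1, r2, r3]
    ring
  have hs := Finset.sum_le_sum fun j (_ : j ∈ Finset.univ) => key j
  refine le_trans (le_of_eq ?_) hs
  rw [Finset.sum_const, Finset.card_univ, Fintype.card_fin, nsmul_eq_mul]
  ring
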